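/- Let N be a relational NFA over an alphabet Σ with finitely many states and set L := L(N). Then the following are equivalent: (i) N is atomic, i.e. for every state z the language L(N_{@z}) belongs to the Boolean subalgebra of the powerset of List Σ generated by the left word quotients {u⁻¹L : u a word}; (ii) for all words x and y: if Lx⁻¹ = Ly⁻¹ (i.e. for all words s, s++x ∈ L ↔ s++y ∈ L) then for every state z, x ∈ L(N_{@z}) ↔ y ∈ L(N_{@z}). Condition (ii) expresses that the reachable subset construction of rev N is isomorphic to the state-minimal DFA of L^r (distinct reachable states accept distinct languages). -/

import Mathlib

/-- A relational nondeterministic finite automaton over alphabet `σ` with states `Z`. -/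
structure RelNFA (σ : Type*) (Z : Type*) where
  /-- initial states -/
  I : Set Z
  /-- final states -/
  F : Set Z
  /-- for each letter, a transition relation -/
  tr : σ → Z → Z → Prop

namespace RelNFA

variable {σ Z : Type*}

/-- `N_w`: the transition relation of the word `w`, with `N_ε` the identity
relation and `N_{u·a} = N_u ; N_a`. -/
def runRel (N : RelNFA σ Z) (w : List σ) : Z → Z → Prop :=
  w.foldl (fun R a => fun z z' => ∃ y, R z y ∧ N.tr a y z') Eq

/-- `N_w[S]`: the relational image of a set of states. -/
def imgSet (N : RelNFA σ Z) (w : List σ) (S : Set Z) : Set Z :=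
  {z' | ∃ z ∈ S, N.runRel w z z'}

/-- The language accepted by `N`: `{w : N_w[I] ∩ F ≠ ∅}`. -/
def lang (N : RelNFA σ Z) : Set (List σ) :=
  {w | (N.imgSet w N.I ∩ N.F).Nonempty}

/-- `L(N_{@z})`: the language accepted by `N` with initial states `{z}`. -/
def langFrom (N : RelNFA σ Z) (z : Z) : Set (List σ) :=
  {w | (N.imgSet w {z} ∩ N.F).Nonempty}

/-- The reverse nfa: swap initial and final states and take converse transitions. -/
def rev (N : RelNFA σ Z) : RelNFA σ Z where
  I := N.F
  F := N.I
  tr := fun a z z' => N.tr a z' z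

end RelNFA

/-- Left quotient of a language by a single word: `u⁻¹L = {w : u++w ∈ L}`. -/
def leftQuot {σ : Type*} (u : List σ) (L : Set (List σ)) : Set (List σ) :=
  {w | u ++ w ∈ L}

/-- Membership in the Boolean subalgebra of the powerset of `α` generated by a
family `S` of subsets. -/
inductive BoolGen {α : Type*} (S : Set (Set α)) : Set α → Prop
  | base {X : Set α} : X ∈ S → BoolGen S X
  | bot : BoolGen S ∅
  | compl {X : Set α} : BoolGen S X → BoolGen S Xᶜ
  | union {X Y : Set α} : BoolGen S X → BoolGen S Y → BoolGen S (X ∪ Y)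

namespace RelNFA

variable {σ Z : Type*}

theorem runRel_append_singleton (N : RelNFA σ Z) (w : List σ) (a : σ) (z z' : Z) :
    N.runRel (w ++ [a]) z z' ↔ ∃ y, N.runRel w z y ∧ N.tr a y z' := by
  simp [runRel, List.foldl_append]

theorem runRel_append (N : RelNFA σ Z) (u v : List σ) (z z' : Z) :
    N.runRel (u ++ v) z z' ↔ ∃ y, N.runRel u z y ∧ N.runRel v y z' := by
  induction v using List.reverseRecOn generalizing z' with
  | nil => simp [runRel]
  | append_singleton v a ih =>
    rw [← List.append_assoc]
    simp only [runRel_append_singleton, ih]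
    constructor
    · rintro ⟨y, ⟨x, hu, hv⟩, ha⟩
      exact ⟨x, hu, y, hv, ha⟩
    · rintro ⟨x, hu, y, hv, ha⟩
      exact ⟨y, ⟨x, hu, hv⟩, ha⟩

theorem leftQuot_lang (N : RelNFA σ Z) (u : List σ) :
    leftQuot u N.lang = ⋃ z ∈ N.imgSet u N.I, N.langFrom z := by
  ext w
  simp only [leftQuot, lang, langFrom, imgSet, runRel_append, Set.Nonempty, Set.mem_inter_iff,
    Set.mem_ofPred_eq, Set.mem_iUnion, Set.mem_singleton_iff, exists_eq_left, exists_prop]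
  constructor
  · rintro ⟨f, ⟨i, hi, y, hu, hw⟩, hf⟩
    exact ⟨y, ⟨i, hi, hu⟩, f, hw, hf⟩
  · rintro ⟨y, ⟨i, hi, hu⟩, f, hw, hf⟩
    exact ⟨f, ⟨i, hi, y, hu, hw⟩, hf⟩

theorem finite_leftQuot_lang [Finite Z] (N : RelNFA σ Z) :
    {Y | ∃ u : List σ, Y = leftQuot u N.lang}.Finite := by
  refine (Set.finite_range fun S : Set Z => ⋃ z ∈ S, N.langFrom z).subset ?_
  rintro _ ⟨u, rfl⟩
  exact ⟨N.imgSet u N.I, (N.leftQuot_lang u).symm⟩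

end RelNFA

namespace BoolGen

variable {α : Type*} {S : Set (Set α)}

theorem mem_iff_mem {X : Set α} (hX : BoolGen S X) {x y : α}
    (h : ∀ Y ∈ S, x ∈ Y ↔ y ∈ Y) : x ∈ X ↔ y ∈ X := by
  induction hX with
  | base hY => exact h _ hY
  | bot => simp
  | compl _ ih => exact not_congr ih
  | union _ _ ih₁ ih₂ => exact or_congr ih₁ ih₂

theorem sUnion {T : Set (Set α)} (hT : T.Finite) (h : ∀ X ∈ T, BoolGen S X) :
    BoolGen S (⋃₀ T) := by
  induction T, hT using Set.Finite.induction_on with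
  | empty => simpa using bot
  | insert _ _ ih =>
    rw [Set.sUnion_insert]
    exact (h _ (Set.mem_insert _ _)).union (ih fun X hX => h X (Set.mem_insert_of_mem _ hX))

theorem sInter {T : Set (Set α)} (hT : T.Finite) (h : ∀ X ∈ T, BoolGen S X) :
    BoolGen S (⋂₀ T) := by
  rw [Set.sInter_eq_compl_sUnion_compl]
  refine (sUnion (hT.image _) ?_).compl
  rintro _ ⟨X, hX, rfl⟩
  exact (h X hX).compl

/-- The Boolean subalgebra generated by a finite family consists of all sets that are
saturated for the relation of belonging to the same members of the family. -/
theorem iff_of_finite (hS : S.Finite) {X : Set α} :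
    BoolGen S X ↔ ∀ x y, (∀ Y ∈ S, x ∈ Y ↔ y ∈ Y) → (x ∈ X ↔ y ∈ X) := by
  refine ⟨fun hX x y => hX.mem_iff_mem, fun hX => ?_⟩
  let atom (T : Set (Set α)) : Set α := ⋂₀ T ∩ ⋂₀ (Compl.compl '' (S \ T))
  let trace (x : α) : Set (Set α) := {Y ∈ S | x ∈ Y}
  have mem_atom (x y : α) : y ∈ atom (trace x) ↔ ∀ Y ∈ S, x ∈ Y ↔ y ∈ Y := by
    simp only [atom, trace, Set.mem_inter_iff, Set.mem_sInter, Set.mem_ofPred_eq,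
      Set.forall_mem_image, Set.mem_sdiff, Set.mem_compl_iff]
    grind
  have gen_atom (x : α) : BoolGen S (atom (trace x)) := by
    have h₁ : BoolGen S (⋂₀ trace x) :=
      sInter (hS.subset (Set.sep_subset _ _)) fun Y hY => base hY.1
    have h₂ : BoolGen S (⋂₀ (Compl.compl '' (S \ trace x))) := by
      refine sInter ((hS.subset Set.sdiff_subset).image _) ?_
      rintro _ ⟨Y, hY, rfl⟩
      exact (base hY.1).compl
    simpa only [atom, Set.compl_union, compl_compl] using (h₁.compl.union h₂.compl).compl
  have hfin : ((fun x => atom (trace x)) '' X).Finite := by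
    refine (hS.finite_subsets.image atom).subset ?_
    rintro _ ⟨x, -, rfl⟩
    exact ⟨trace x, Set.sep_subset _ _, rfl⟩
  have hEq : X = ⋃₀ ((fun x => atom (trace x)) '' X) := by
    ext y
    simp only [Set.sUnion_image, Set.mem_iUnion, mem_atom, exists_prop]
    exact ⟨fun hy => ⟨y, hy, fun _ _ => Iff.rfl⟩, fun ⟨x, hx, h⟩ => (hX x y h).1 hx⟩
  rw [hEq]
  refine sUnion hfin ?_
  rintro _ ⟨x, -, rfl⟩
  exact gen_atom x

end BoolGen

/-- An nfa `N` (with finitely many states) is atomic — every state accepts a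
Boolean combination of left word quotients of `L := L(N)` — iff whenever two
words have equal right word quotients (`Lx⁻¹ = Ly⁻¹`) they are accepted from
exactly the same states; i.e. iff the reachable subset construction of `rev N`
is isomorphic to the state-minimal dfa of `L^r`. -/
theorem atomic_iff_rsc_rev_minimal {σ Z : Type*} [Fintype Z] (N : RelNFA σ Z) :
    (∀ z : Z, BoolGen {Y | ∃ u : List σ, Y = leftQuot u N.lang} (N.langFrom z)) ↔
    (∀ x y : List σ, (∀ s : List σ, s ++ x ∈ N.lang ↔ s ++ y ∈ N.lang) →
      ∀ z : Z, (x ∈ N.langFrom z ↔ y ∈ N.langFrom z)) := by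
  simp only [BoolGen.iff_of_finite N.finite_leftQuot_lang, Set.mem_ofPred_eq,
    forall_exists_index, forall_eq_apply_imp_iff]
  exact ⟨fun h x y hxy z => h z x y hxy, fun h z x y hxy => h x y hxy z⟩
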